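/- Let Γ be a Bernoulli congestion game with affine costs c_e(x) = a_e·x + b_e where a_e, b_e ≥ 0, heterogeneous participation probabilities p_i ∈ [0,1], and let q ∈ (0,1] satisfy p_i ≤ q for all players i. Then for every pure Bayes–Nash equilibrium s* and every strategy profile s', the expected social cost satisfies C(s*) ≤ B(q)·C(s'), where B(q) = 4/3 if q ≤ 1/4; B(q) = (1 + q + √(q(2+q)))/(1 − q + √(q(2+q))) if 1/4 ≤ q and 8q³+4q² ≤ 1; and B(q) = 1 + q + q²/(1+q) if 8q³+4q² ≥ 1. -/

import Mathlib

open Finset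

/-- Probability that the set of active players is exactly `I`:
`p(I) = ∏_{j∈I} p_j · ∏_{j∉I} (1 − p_j)`. -/
noncomputable def probOf {ι : Type*} [Fintype ι] [DecidableEq ι]
    (p : ι → ℝ) (I : Finset ι) : ℝ :=
  (∏ j ∈ I, p j) * ∏ j ∈ Iᶜ, (1 - p j)

/-- Load of resource `e` under the profile `s` when the active set is `I`:
`N_e(s,I) = |{ j ∈ I : e ∈ s_j }|`. -/
def load {ι E : Type*} [DecidableEq E]
    (s : ι → Finset E) (I : Finset ι) (e : E) : ℕ :=
  (I.filter fun j => e ∈ s j).card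

/-- Expected cost of player `i`:
`C_i(s) = Σ_{e ∈ s_i} Σ_{I ⊆ N, i ∈ I} p(I) · c_e(N_e(s,I))`. -/
noncomputable def playerCost {ι E : Type*} [Fintype ι] [DecidableEq ι] [DecidableEq E]
    (p : ι → ℝ) (c : E → ℕ → ℝ) (s : ι → Finset E) (i : ι) : ℝ :=
  ∑ e ∈ s i, ∑ I ∈ (Finset.univ : Finset (Finset ι)).filter (fun I => i ∈ I),
    probOf p I * c e (load s I e)

/-- The price-of-anarchy bound `B(q)`:
`4/3` for `q ≤ 1/4`, `(1 + q + √(q(2+q)))/(1 − q + √(q(2+q)))` for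
`1/4 ≤ q` with `8q³+4q² ≤ 1`, and `1 + q + q²/(1+q)` for `8q³+4q² ≥ 1`. -/
noncomputable def Bpoa (q : ℝ) : ℝ :=
  if q ≤ 1 / 4 then 4 / 3
  else if 8 * q ^ 3 + 4 * q ^ 2 ≤ 1 then
    (1 + q + Real.sqrt (q * (2 + q))) / (1 - q + Real.sqrt (q * (2 + q)))
  else 1 + q + q ^ 2 / (1 + q)

/-- The event that all players of `K` are active has probability `∏ j ∈ K, p j`. -/
lemma sum_probOf_superset {ι : Type*} [Fintype ι] [DecidableEq ι] (p : ι → ℝ) (K : Finset ι) :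
    ∑ I, (if K ⊆ I then probOf p I else 0) = ∏ j ∈ K, p j := by
  have h := Finset.prod_add (fun j => p j) (fun j => if j ∈ K then 0 else 1 - p j)
    (Finset.univ : Finset ι)
  have hl : ∏ j, (p j + if j ∈ K then 0 else 1 - p j) = ∏ j ∈ K, p j := by
    rw [← Finset.prod_subset (Finset.subset_univ K)]
    · exact Finset.prod_congr rfl fun j hj => by simp [hj]
    · intro j _ hj
      simp [hj]
  rw [← hl, h, Finset.powerset_univ]
  refine Finset.sum_congr rfl fun I _ => ?_
  rw [← Finset.compl_eq_univ_sdiff]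
  split_ifs with hK
  · unfold probOf
    congr 1
    refine Finset.prod_congr rfl fun j hj => ?_
    rw [if_neg fun hjK => Finset.mem_compl.1 hj (hK hjK)]
  · obtain ⟨j, hjK, hjI⟩ := Finset.not_subset.1 hK
    rw [Finset.prod_eq_zero (Finset.mem_compl.2 hjI) (by simp [hjK]), mul_zero]

lemma sum_probOf_mem {ι : Type*} [Fintype ι] [DecidableEq ι] (p : ι → ℝ) (i : ι) :
    ∑ I, (if i ∈ I then probOf p I else 0) = p i := by
  simpa using sum_probOf_superset p {i}

lemma sum_probOf_mem_mem {ι : Type*} [Fintype ι] [DecidableEq ι] (p : ι → ℝ) {i j : ι}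
    (hij : i ≠ j) :
    ∑ I, (if i ∈ I ∧ j ∈ I then probOf p I else 0) = p i * p j := by
  have h := sum_probOf_superset p {i, j}
  rw [Finset.prod_pair hij] at h
  simpa [Finset.insert_subset_iff] using h

lemma probOf_nonneg {ι : Type*} [Fintype ι] [DecidableEq ι] {p : ι → ℝ}
    (hp : ∀ i, p i ∈ Set.Icc (0 : ℝ) 1) (I : Finset ι) : 0 ≤ probOf p I :=
  mul_nonneg (Finset.prod_nonneg fun j _ => (hp j).1)
    (Finset.prod_nonneg fun j _ => sub_nonneg.2 (hp j).2)

/-- Probability that the distinct players `i` and `j` are both active; zero when `i = j`. -/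
noncomputable def pairProb {ι : Type*} [DecidableEq ι] (p : ι → ℝ) (i j : ι) : ℝ :=
  if i = j then 0 else p i * p j

/-- Players using resource `e` under the profile `s`. -/
def users {ι E : Type*} [Fintype ι] [DecidableEq E] (s : ι → Finset E) (e : E) : Finset ι :=
  Finset.univ.filter fun j => e ∈ s j

/-- Total expected cost, on a resource with unit linear cost, of the players of `B` when each of
them faces, besides himself, the other players of `A`. -/
noncomputable def crossCost {ι : Type*} [DecidableEq ι] (p : ι → ℝ) (B A : Finset ι) : ℝ :=
  ∑ i ∈ B, (p i + ∑ j ∈ A, pairProb p i j)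

lemma sum_probOf_mul_load {ι E : Type*} [Fintype ι] [DecidableEq ι] [DecidableEq E]
    (p : ι → ℝ) (s : ι → Finset E) {i : ι} {e : E} (he : e ∈ s i) :
    ∑ I ∈ (Finset.univ : Finset (Finset ι)).filter (fun I => i ∈ I),
      probOf p I * (load s I e : ℝ) = p i + ∑ j ∈ users s e, pairProb p i j := by
  have hload : ∀ I : Finset ι, (load s I e : ℝ) = ∑ j ∈ users s e, if j ∈ I then (1 : ℝ) else 0 := by
    intro I
    rw [Finset.sum_boole, load, users]
    congr 2
    ext j
    simp [and_comm]
  have hi : i ∈ users s e := by simp [users, he]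
  have hpair : ∀ j, ∑ I, (if i ∈ I then probOf p I * (if j ∈ I then (1 : ℝ) else 0) else 0)
      = (if i = j then p i else 0) + pairProb p i j := by
    intro j
    unfold pairProb
    split_ifs with hij
    · subst hij
      rw [add_zero, ← sum_probOf_mem p i]
      exact Finset.sum_congr rfl fun I _ => by split_ifs <;> simp
    · rw [zero_add, ← sum_probOf_mem_mem p hij]
      exact Finset.sum_congr rfl fun I _ => by split_ifs <;> simp_all
  calc _ = ∑ I, ∑ j ∈ users s e,
        (if i ∈ I then probOf p I * (if j ∈ I then (1 : ℝ) else 0) else 0) := by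
        rw [Finset.sum_filter]
        refine Finset.sum_congr rfl fun I _ => ?_
        split_ifs
        · rw [hload, Finset.mul_sum]
        · simp
    _ = ∑ j ∈ users s e, ((if i = j then p i else 0) + pairProb p i j) := by
        rw [Finset.sum_comm]
        exact Finset.sum_congr rfl fun j _ => hpair j
    _ = _ := by rw [Finset.sum_add_distrib, Finset.sum_ite_eq, if_pos hi]

lemma playerCost_affine {ι E : Type*} [Fintype ι] [DecidableEq ι] [DecidableEq E]
    (p : ι → ℝ) (a b : E → ℝ) (s : ι → Finset E) (i : ι) :
    playerCost p (fun e x => a e * (x : ℝ) + b e) s i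
      = ∑ e ∈ s i, (a e * (p i + ∑ j ∈ users s e, pairProb p i j) + b e * p i) := by
  refine Finset.sum_congr rfl fun e he => ?_
  rw [← sum_probOf_mul_load p s he, ← sum_probOf_mem p i, ← Finset.sum_filter, Finset.mul_sum,
    Finset.mul_sum, ← Finset.sum_add_distrib]
  exact Finset.sum_congr rfl fun I _ => by ring

lemma sum_pairProb_users_update {ι E : Type*} [Fintype ι] [DecidableEq ι] [DecidableEq E]
    (p : ι → ℝ) (s : ι → Finset E) (i : ι) (t : Finset E) (e : E) :
    ∑ j ∈ users (Function.update s i t) e, pairProb p i j = ∑ j ∈ users s e, pairProb p i j := by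
  unfold users
  rw [Finset.sum_filter, Finset.sum_filter]
  refine Finset.sum_congr rfl fun j _ => ?_
  by_cases hij : i = j
  · simp [pairProb, hij]
  · rw [Function.update_of_ne (Ne.symm hij)]

/-- Summing player costs against a possibly different profile, resource by resource. -/
lemma sum_players_eq_sum_resources {ι E : Type*} [Fintype ι] [DecidableEq ι] [Fintype E]
    [DecidableEq E] (p : ι → ℝ) (a b : E → ℝ) (s t : ι → Finset E) :
    ∑ i, ∑ e ∈ t i, (a e * (p i + ∑ j ∈ users s e, pairProb p i j) + b e * p i)
      = ∑ e, (a e * crossCost p (users t e) (users s e) + b e * ∑ i ∈ users t e, p i) := by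
  rw [Finset.sum_comm' (t' := Finset.univ) (s' := fun e => users t e)
    (by intro i e; simp [users])]
  refine Finset.sum_congr rfl fun e _ => ?_
  rw [Finset.sum_add_distrib, ← Finset.mul_sum, ← Finset.mul_sum, crossCost]

/-- `crossCost` is multilinear in the probabilities, hence an average of its values at the
vertices of the cube `{0, q}^ι`. -/
lemma crossCost_eq_sum_vertices {ι : Type*} [Fintype ι] [DecidableEq ι] (r : ι → ℝ) (q : ℝ)
    (B A : Finset ι) :
    crossCost (fun i => q * r i) B A
      = ∑ T, probOf r T * crossCost (fun i => if i ∈ T then q else 0) B A := by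
  have h1 : ∀ i, q * r i = ∑ T, probOf r T * (if i ∈ T then q else 0) := by
    intro i
    rw [← sum_probOf_mem r i, Finset.mul_sum]
    exact Finset.sum_congr rfl fun T _ => by split_ifs <;> ring
  have h2 : ∀ i j, pairProb (fun i => q * r i) i j
      = ∑ T, probOf r T * pairProb (fun i => if i ∈ T then q else 0) i j := by
    intro i j
    unfold pairProb
    split_ifs with hij
    · simp
    · rw [mul_mul_mul_comm, ← sum_probOf_mem_mem r hij, Finset.mul_sum]
      refine Finset.sum_congr rfl fun T _ => ?_
      by_cases hi : i ∈ T <;> by_cases hj : j ∈ T <;> simp [hi, hj]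
      ring
  unfold crossCost
  simp_rw [Finset.mul_sum, mul_add, Finset.mul_sum]
  rw [Finset.sum_comm]
  refine Finset.sum_congr rfl fun i _ => ?_
  rw [Finset.sum_add_distrib, Finset.sum_comm, ← h1]
  simp_rw [← h2]

lemma crossCost_vertex {ι : Type*} [DecidableEq ι] (q : ℝ) (T B A : Finset ι) :
    crossCost (fun i => if i ∈ T then q else 0) B A
      = q * (#(B ∩ T) : ℝ) + q ^ 2 * ((#(B ∩ T) : ℝ) * (#(A ∩ T) : ℝ) - (#(B ∩ A ∩ T) : ℝ)) := by
  have hsum : ∀ D : Finset ι, ∑ i ∈ D, (if i ∈ T then q else 0) = q * (#(D ∩ T) : ℝ) := by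
    intro D
    rw [← Finset.sum_filter, Finset.filter_mem_eq_inter, Finset.sum_const, nsmul_eq_mul, mul_comm]
  have hoff : ∀ i j, pairProb (fun i => if i ∈ T then q else 0) i j
      = (if i ∈ T then q else 0) * (if j ∈ T then q else 0)
        - (if i = j then q * (if i ∈ T then q else 0) else 0) := by
    intro i j
    unfold pairProb
    split_ifs <;> simp_all
  have hdiag : ∑ i ∈ B, (if i ∈ A then q * (if i ∈ T then q else 0) else 0)
      = q * (q * (#(B ∩ A ∩ T) : ℝ)) := by
    rw [← Finset.sum_filter, Finset.filter_mem_eq_inter, ← Finset.mul_sum, hsum]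
  unfold crossCost
  simp_rw [hoff, Finset.sum_sub_distrib, Finset.sum_ite_eq, ← Finset.mul_sum]
  rw [Finset.sum_add_distrib, Finset.sum_sub_distrib, ← Finset.sum_mul, hdiag, hsum, hsum]
  ring

/-- The smoothness inequality for homogeneous participation probability `q`, over loads. -/
def IsSmooth (q l μ : ℝ) : Prop :=
  ∀ m k : ℕ, (m : ℝ) * (1 + q * k) ≤ l * (m * (1 - q + q * m)) + μ * (k * (1 - q + q * k))

lemma IsSmooth.crossCost_le {ι : Type*} [Fintype ι] [DecidableEq ι] {p : ι → ℝ} {q l μ : ℝ}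
    (h : IsSmooth q l μ) (hq : 0 < q) (hp : ∀ i, 0 ≤ p i) (hpq : ∀ i, p i ≤ q)
    (A B : Finset ι) :
    crossCost p B A ≤ l * crossCost p B B + μ * crossCost p A A := by
  obtain ⟨r, rfl⟩ : ∃ r : ι → ℝ, p = fun i => q * r i :=
    ⟨fun i => p i / q, by ext i; field_simp⟩
  have hr : ∀ i, r i ∈ Set.Icc (0 : ℝ) 1 := fun i =>
    ⟨nonneg_of_mul_nonneg_right (hp i) hq, by
      have := hpq i
      exact le_of_mul_le_mul_left (by simpa using this) hq⟩
  simp_rw [crossCost_eq_sum_vertices r q]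
  rw [Finset.mul_sum, Finset.mul_sum, ← Finset.sum_add_distrib]
  refine Finset.sum_le_sum fun T _ => ?_
  rw [mul_left_comm l, mul_left_comm μ, ← mul_add]
  refine mul_le_mul_of_nonneg_left ?_ (probOf_nonneg hr T)
  simp only [crossCost_vertex, Finset.inter_self]
  have hs := mul_le_mul_of_nonneg_left (h #(B ∩ T) #(A ∩ T)) hq.le
  have hnn : 0 ≤ q ^ 2 * (#(B ∩ A ∩ T) : ℝ) := by positivity
  nlinarith

lemma social_cost_le_of_isSmooth {ι E : Type*} [Fintype ι] [DecidableEq ι] [Fintype E]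
    [DecidableEq E] {a b : E → ℝ} {p : ι → ℝ} {q l μ : ℝ} (h : IsSmooth q l μ)
    (hl : 1 ≤ l) (hμ : 0 ≤ μ) (hμ1 : μ < 1) (ha : ∀ e, 0 ≤ a e) (hb : ∀ e, 0 ≤ b e)
    (hq : 0 < q) (hp : ∀ i, 0 ≤ p i) (hpq : ∀ i, p i ≤ q) (s t : ι → Finset E)
    (heq : ∀ i, playerCost p (fun e x => a e * (x : ℝ) + b e) s i
      ≤ playerCost p (fun e x => a e * (x : ℝ) + b e) (Function.update s i (t i)) i) :
    ∑ i, playerCost p (fun e x => a e * (x : ℝ) + b e) s i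
      ≤ l / (1 - μ) * ∑ i, playerCost p (fun e x => a e * (x : ℝ) + b e) t i := by
  have hdev := Finset.sum_le_sum fun i (_ : i ∈ Finset.univ) => heq i
  simp_rw [playerCost_affine, Function.update_self, sum_pairProb_users_update,
    sum_players_eq_sum_resources] at hdev ⊢
  have hres : ∑ e, (a e * crossCost p (users t e) (users s e) + b e * ∑ i ∈ users t e, p i)
      ≤ l * ∑ e, (a e * crossCost p (users t e) (users t e) + b e * ∑ i ∈ users t e, p i)
        + μ * ∑ e, (a e * crossCost p (users s e) (users s e) + b e * ∑ i ∈ users s e, p i) := by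
    rw [Finset.mul_sum, Finset.mul_sum, ← Finset.sum_add_distrib]
    refine Finset.sum_le_sum fun e _ => ?_
    have hlin := mul_le_mul_of_nonneg_left (h.crossCost_le hq hp hpq (users s e) (users t e)) (ha e)
    have ht : 0 ≤ b e * ∑ i ∈ users t e, p i :=
      mul_nonneg (hb e) (Finset.sum_nonneg fun i _ => hp i)
    have hs : 0 ≤ b e * ∑ i ∈ users s e, p i :=
      mul_nonneg (hb e) (Finset.sum_nonneg fun i _ => hp i)
    nlinarith [mul_nonneg (sub_nonneg.2 hl) ht, mul_nonneg hμ hs]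
  rw [div_mul_eq_mul_div, le_div_iff₀ (sub_pos.2 hμ1)]
  linarith

lemma isSmooth_of_le_quarter {q : ℝ} (hq0 : 0 < q) (hq : q ≤ 1 / 4) : IsSmooth q 1 (1 / 4) := by
  intro m k
  have hk : (0 : ℝ) ≤ k := k.cast_nonneg
  have key : 0 ≤ ((m : ℝ) - k / 2) ^ 2 - m + 3 * k / 4 := by
    rcases Nat.eq_zero_or_pos k with rfl | hk1
    · have : (m : ℝ) ≤ m * m := by exact_mod_cast Nat.le_mul_self m
      norm_num
      nlinarith
    · have : (1 : ℝ) ≤ k := by exact_mod_cast hk1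
      nlinarith [sq_nonneg ((m : ℝ) - k / 2 - 1 / 2)]
  nlinarith [mul_nonneg hq0.le key, mul_nonneg hk (sub_nonneg.2 hq)]

lemma isSmooth_of_large {q : ℝ} (hq0 : 0 < q) (hq1 : q ≤ 1) (hq : 1 ≤ 8 * q ^ 3 + 4 * q ^ 2) :
    IsSmooth q ((1 + 2 * q + 2 * q ^ 2) / (1 + 2 * q)) (q / (1 + 2 * q)) := by
  have hq38 : 3 / 8 ≤ q := by
    by_contra! hlt
    nlinarith [mul_pos hq0 hq0, mul_pos hq0 (mul_pos hq0 hq0), mul_pos hq0 (sub_pos.2 hlt),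
      mul_pos (mul_pos hq0 hq0) (sub_pos.2 hlt)]
  intro m k
  -- a positive multiple of the difference of the two sides
  have key : 0 ≤ q * (k : ℝ) ^ 2 + k * (1 - q - m * (1 + 2 * q))
      + m * (m * (1 + 2 * q + 2 * q ^ 2) - 1 - 2 * q ^ 2) := by
    rcases Nat.lt_or_ge m 2 with hm | hm
    · interval_cases m
      · have hk : (0 : ℝ) ≤ k := k.cast_nonneg
        norm_num
        nlinarith [mul_nonneg hk (sub_nonneg.2 hq1), mul_nonneg hq0.le (sq_nonneg (k : ℝ))]
      · have hint : (0 : ℝ) ≤ (k - 1) * (k - 2) := by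
          rcases Nat.lt_or_ge k 2 with hk | hk
          · interval_cases k <;> norm_num
          · have : (2 : ℝ) ≤ k := by exact_mod_cast hk
            nlinarith
        norm_num
        nlinarith [mul_nonneg hq0.le hint]
    · have hm2 : (2 : ℝ) ≤ m := by exact_mod_cast hm
      have hd : 0 ≤ (m : ℝ) ^ 2 * (8 * q ^ 3 + 4 * q ^ 2 - 1)
          + 2 * m * (1 - q - 2 * q ^ 2 - 4 * q ^ 3) - (1 - q) ^ 2 := by
        have hbase : 0 ≤ 16 * q ^ 3 + 7 * q ^ 2 - 2 * q - 1 := by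
          nlinarith [mul_nonneg (sub_nonneg.2 hq38) (sq_nonneg q),
            mul_nonneg (sub_nonneg.2 hq38) hq0.le]
        have hslope : 0 ≤ 24 * q ^ 3 + 12 * q ^ 2 - 2 * q - 2 := by
          nlinarith [mul_nonneg (sub_nonneg.2 hq38) (sq_nonneg q),
            mul_nonneg (sub_nonneg.2 hq38) hq0.le]
        nlinarith [mul_nonneg (sub_nonneg.2 hm2) hslope,
          mul_nonneg (mul_nonneg (sub_nonneg.2 hm2) (sub_nonneg.2 hm2)) (sub_nonneg.2 hq)]
      have h4q : 0 ≤ 4 * q * (q * (k : ℝ) ^ 2 + k * (1 - q - m * (1 + 2 * q))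
          + m * (m * (1 + 2 * q + 2 * q ^ 2) - 1 - 2 * q ^ 2)) := by
        nlinarith [sq_nonneg (2 * q * k + (1 - q - m * (1 + 2 * q)))]
      exact nonneg_of_mul_nonneg_right h4q (by positivity)
  rw [div_mul_eq_mul_div, div_mul_eq_mul_div, ← add_div, le_div_iff₀ (by positivity)]
  nlinarith [mul_nonneg hq0.le key]

/-- Smoothness in the intermediate range, with `l` and `μ` the roots of
`x² - (1 + q) x + 1/4`. -/
lemma isSmooth_of_middle {q w : ℝ} (hq14 : 1 / 4 ≤ q) (hq : 8 * q ^ 3 + 4 * q ^ 2 ≤ 1)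
    (hw0 : 0 ≤ w) (hw : w ^ 2 = q * (2 + q)) :
    IsSmooth q ((1 + q + w) / 2) ((1 + q - w) / 2) := by
  have hq0 : 0 < q := by linarith
  have hq' : q ≤ 378 / 1000 := by
    by_contra! hlt
    nlinarith [mul_pos hq0 (sub_pos.2 hlt), mul_pos (mul_pos hq0 hq0) (sub_pos.2 hlt)]
  -- the chord of the concave function `q ↦ √(q (2 + q))` over the range of `q`
  have hchord : 3 / 4 + 1547 / 1000 * (q - 1 / 4) ≤ w := by
    refine abs_le_of_sq_le_sq' ?_ hw0 |>.2
    rw [hw]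
    nlinarith [mul_nonneg (sub_nonneg.2 hq14) (sub_nonneg.2 hq')]
  obtain ⟨l, hl⟩ : ∃ l, l = (1 + q + w) / 2 := ⟨_, rfl⟩
  obtain ⟨μ, hμ⟩ : ∃ μ, μ = (1 + q - w) / 2 := ⟨_, rfl⟩
  rw [← hl, ← hμ]
  have hsum : l + μ = 1 + q := by rw [hl, hμ]; ring
  have hprod : 4 * (l * μ) = 1 := by rw [hl, hμ]; linarith
  have hl1 : 1 ≤ l := by rw [hl]; linarith
  have hμ0 : 0 < μ := by nlinarith
  have hμ14 : μ ≤ 1 / 4 := by nlinarith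
  intro m k
  have hm : (0 : ℝ) ≤ m := m.cast_nonneg
  have hk : (0 : ℝ) ≤ k := k.cast_nonneg
  have hmono : ∀ y : ℝ, 0 ≤ y → 1 * y ≤ l * y := fun y hy => mul_le_mul_of_nonneg_right hl1 hy
  rcases Nat.lt_or_ge k 3 with hk3 | hk3
  · interval_cases k
    · have hmm : (m : ℝ) ≤ m * m := by exact_mod_cast Nat.le_mul_self m
      have := hmono (m * (1 - q + q * m))
          (mul_nonneg hm (by linarith [mul_nonneg hq0.le hm]))
      norm_num
      nlinarith
    · rcases Nat.lt_or_ge m 2 with hm2 | hm2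
      · interval_cases m <;> norm_num <;> linarith
      · have hm2' : (2 : ℝ) ≤ m := by exact_mod_cast hm2
        have hfac : 0 ≤ ((m : ℝ) - 1) * (l * q * m - μ) := by
          refine mul_nonneg (by linarith) ?_
          nlinarith [mul_le_mul hl1 hq14 (by norm_num) (by linarith)]
        norm_num
        nlinarith
    · rcases Nat.lt_or_ge m 3 with hm3 | hm3
      · interval_cases m
        · norm_num
          nlinarith
        · have hthr : q ≤ μ * (1 + 2 * q) := by
            have : w ≤ (1 + q) - 2 * q / (1 + 2 * q) := by
              have hpos : 0 ≤ (1 + q) - 2 * q / (1 + 2 * q) := by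
                have : 2 * q / (1 + 2 * q) ≤ 1 := by
                  rw [div_le_one (by positivity)]; linarith
                linarith
              refine abs_le_of_sq_le_sq' ?_ hpos |>.2
              rw [hw]
              have : (1 + q - 2 * q / (1 + 2 * q)) ^ 2 - q * (2 + q)
                  = (1 - 8 * q ^ 3 - 4 * q ^ 2) / (1 + 2 * q) ^ 2 := by
                field_simp
                ring
              have h2 : 0 ≤ (1 - 8 * q ^ 3 - 4 * q ^ 2) / (1 + 2 * q) ^ 2 :=
                div_nonneg (by linarith) (by positivity)
              linarith
            have h3 : q / (1 + 2 * q) ≤ μ := by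
              rw [hμ]
              rw [mul_div_assoc] at this
              linarith
            rwa [div_le_iff₀ (by positivity)] at h3
          norm_num
          nlinarith
        · norm_num
          nlinarith
      · have hm3' : (3 : ℝ) ≤ m := by exact_mod_cast hm3
        have := hmono (m * (1 - q + q * m))
          (mul_nonneg hm (by linarith [mul_nonneg hq0.le hm]))
        norm_num
        nlinarith [mul_nonneg (mul_nonneg hq0.le hm) (sub_nonneg.2 hm3')]
  · have hk3' : (3 : ℝ) ≤ k := by exact_mod_cast hk3
    have hcoef : 0 ≤ (1 - q) * (1 + 2 * l) - 2 := by
      rw [hl]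
      nlinarith [mul_le_mul_of_nonneg_left hchord (by linarith : 0 ≤ 1 - q),
        mul_nonneg (sub_nonneg.2 hq14) (sub_nonneg.2 hq')]
    have hdisc : (l * (1 - q) - 1) ^ 2 ≤ 3 * q * ((1 - q) * (1 + 2 * l) - 2) := by
      have hv : 1 + 2 * q + 11 * q ^ 2 + 12 * q ^ 3 + 2 * q ^ 4
          ≤ w * ((1 - q) * (2 + 2 * q ^ 2 + 12 * q)) := by
        refine le_trans ?_ (mul_le_mul_of_nonneg_right hchord
          (mul_nonneg (by linarith) (by positivity)))
        nlinarith [mul_nonneg (sub_nonneg.2 hq14) (sub_nonneg.2 hq'),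
          mul_nonneg hq0.le (mul_nonneg (sub_nonneg.2 hq14) (sub_nonneg.2 hq')),
          mul_nonneg (sq_nonneg q) (mul_nonneg (sub_nonneg.2 hq14) (sub_nonneg.2 hq'))]
      have hv2 : (w * (1 - q)) ^ 2 = q * (2 + q) * (1 - q) ^ 2 := by rw [mul_pow, hw]
      rw [hl]
      nlinarith
    have hdisc_k : (l * (1 - q) - 1) ^ 2 ≤ k * q * ((1 - q) * (1 + 2 * l) - 2) := by
      nlinarith [mul_nonneg (mul_nonneg (sub_nonneg.2 hk3') hq0.le) hcoef]
    obtain ⟨d, hd⟩ : ∃ d : ℝ, (m : ℝ) = d + 2 * μ * k := ⟨m - 2 * μ * k, by ring⟩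
    have hquad : 0 ≤ l * q * d ^ 2 + (l * (1 - q) - 1) * d
        + k * μ * ((1 - q) * (1 + 2 * l) - 2) := by
      have hpos : 0 < 4 * (l * q) := by positivity
      refine nonneg_of_mul_nonneg_right (a := 4 * (l * q)) ?_ hpos
      have hid : 4 * (l * q) * (l * q * d ^ 2 + (l * (1 - q) - 1) * d
          + k * μ * ((1 - q) * (1 + 2 * l) - 2))
          = (2 * (l * q) * d + (l * (1 - q) - 1)) ^ 2 - (l * (1 - q) - 1) ^ 2
            + 4 * (l * μ) * (k * q * ((1 - q) * (1 + 2 * l) - 2)) := by ring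
      rw [hid, hprod]
      nlinarith [sq_nonneg (2 * (l * q) * d + (l * (1 - q) - 1))]
    have hid : l * ((m : ℝ) * (1 - q + q * m)) + μ * (k * (1 - q + q * k)) - m * (1 + q * k)
        = l * q * d ^ 2 + (l * (1 - q) - 1) * d + k * μ * ((1 - q) * (1 + 2 * l) - 2)
          + (4 * (l * μ) - 1) * (q * k * d + q * μ * k ^ 2) := by
      rw [hd]
      ring
    rw [hprod] at hid
    linarith

/-- Smoothness parameters realising the bound `Bpoa q`. -/
lemma exists_isSmooth_Bpoa {q : ℝ} (hq0 : 0 < q) (hq1 : q ≤ 1) :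
    ∃ l μ, IsSmooth q l μ ∧ 1 ≤ l ∧ 0 ≤ μ ∧ μ < 1 ∧ l / (1 - μ) = Bpoa q := by
  unfold Bpoa
  split_ifs with h1 h2
  · exact ⟨1, 1 / 4, isSmooth_of_le_quarter hq0 h1, by norm_num⟩
  · push Not at h1
    have hw := Real.sq_sqrt (show 0 ≤ q * (2 + q) by positivity)
    have hw0 := Real.sqrt_nonneg (q * (2 + q))
    set w := Real.sqrt (q * (2 + q))
    have hlow : 1 - q ≤ w := by
      refine abs_le_of_sq_le_sq' ?_ hw0 |>.2
      nlinarith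
    have hhigh : w ≤ 1 + q := by
      refine abs_le_of_sq_le_sq' ?_ (by linarith) |>.2
      nlinarith
    have hpos : 0 < 1 - q + w := by nlinarith
    refine ⟨_, _, isSmooth_of_middle h1.le h2 hw0 hw, by linarith, by linarith, by linarith, ?_⟩
    rw [show 1 - (1 + q - w) / 2 = (1 - q + w) / 2 by ring]
    field_simp
  · refine ⟨_, _, isSmooth_of_large hq0 hq1 (not_le.1 h2).le, ?_, by positivity, ?_, ?_⟩
    · rw [le_div_iff₀ (by positivity)]
      nlinarith
    · rw [div_lt_one (by positivity)]
      linarith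
    · rw [show 1 - q / (1 + 2 * q) = (1 + q) / (1 + 2 * q) by field_simp; ring]
      field_simp
      ring

/-- In a Bernoulli congestion game with affine costs `c_e(x) = a_e·x + b_e`
(`a_e, b_e ≥ 0`) and heterogeneous participation probabilities `p_i ∈ [0,1]`
bounded above by `q ∈ (0,1]`, the expected social cost of every pure
Bayes–Nash equilibrium `s*` is at most `B(q)` times the expected social cost
of any strategy profile `s'`. -/
theorem bernoulli_affine_poa_hetero
    {ι E : Type*} [Fintype ι] [DecidableEq ι] [Fintype E] [DecidableEq E]
    (S : ι → Finset (Finset E)) (a b : E → ℝ) (p : ι → ℝ) (q : ℝ)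
    (hS : ∀ i, (S i).Nonempty) (ha : ∀ e, 0 ≤ a e) (hb : ∀ e, 0 ≤ b e)
    (hp : ∀ i, p i ∈ Set.Icc (0 : ℝ) 1) (hq0 : 0 < q) (hq1 : q ≤ 1)
    (hpq : ∀ i, p i ≤ q)
    (sstar s' : ι → Finset E)
    (hstar : ∀ i, sstar i ∈ S i) (hs' : ∀ i, s' i ∈ S i)
    (heq : ∀ i, ∀ si ∈ S i,
      playerCost p (fun e x => a e * (x : ℝ) + b e) sstar i
        ≤ playerCost p (fun e x => a e * (x : ℝ) + b e)
            (Function.update sstar i si) i) :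
    ∑ i, playerCost p (fun e x => a e * (x : ℝ) + b e) sstar i
      ≤ Bpoa q * ∑ i, playerCost p (fun e x => a e * (x : ℝ) + b e) s' i := by
  obtain ⟨l, μ, hsm, hl, hμ, hμ1, hB⟩ := exists_isSmooth_Bpoa hq0 hq1
  rw [← hB]
  exact social_cost_le_of_isSmooth hsm hl hμ hμ1 ha hb hq0 (fun i => (hp i).1) hpq sstar s'
    fun i => heq i (s' i) (hs' i)
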